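/- Let n ≥ 3, 0 ≤ l < k ≤ n, and let A = diag(a₁,…,aₙ) ∈ 𝒜ˢ_{k,l} be diagonal. Assume g ∈ C⁰ satisfies inf g > 0 and limsup_{|x|→∞}|x|^β|g(x)−1| < ∞ for some β > 2, and let C₀, s₀ > 1 be such that g(x) ≤ 1 + C₀ s^{−β/2} whenever s := ½xᵀAx ≥ s₀. Set ℋ := (k−l)/(2H_k(A)) and ḡ(t) := 1 + C₀ t^{−β/2}. Then there exists C̃ > 1 (depending on A and β) such that for every c₁ > C̃ and every c₂ ∈ ℝ, the generalized symmetric function w_{c₁,c₂}(x) := c₂ + ∫_{s₀}^{s} ( η^{−ℋ}( ∫_1^η ℋ t^{ℋ−1} ḡ(t) dt + c₁ ) )^{1/(k−l)} dη (with s = ½xᵀAx) satisfies: (i) λ(D²w_{c₁,c₂}(x)) ∈ Γ_k and σ_k(λ(D²w_{c₁,c₂}(x)))/σ_l(λ(D²w_{c₁,c₂}(x))) ≥ g(x) for all x with ½xᵀAx ≥ s₀; (ii) w_{c₁,c₂}(x) = ½xᵀAx + μ(c₁,c₂) + O(|x|^{2−min{β,(k−l)/H_k(A)}}) as |x|→∞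 if β ≠ (k−l)/H_k(A), and w_{c₁,c₂}(x) = ½xᵀAx + μ(c₁,c₂) + O(|x|^{2−(k−l)/H_k(A)} ln|x|) if β = (k−l)/H_k(A), where μ(c₁,c₂) = c₂ − s₀ + ∫_{s₀}^∞ (w'_{c₁,c₂}(η) − 1) dη is finite. -/

import Mathlib

open scoped BigOperators
open Filter MeasureTheory

noncomputable section

/-- The `j`-th elementary symmetric function of `lam ∈ ℝⁿ`. -/
def esym (n j : ℕ) (lam : Fin n → ℝ) : ℝ :=
  ∑ S ∈ Finset.powersetCard j (Finset.univ : Finset (Fin n)), ∏ i ∈ S, lam i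

/-- `σ_{j;i}`: the `j`-th elementary symmetric function with the `i`-th variable set to `0`. -/
def esymRem (n j : ℕ) (lam : Fin n → ℝ) (i : Fin n) : ℝ :=
  esym n j (Function.update lam i 0)

/-- The increasingly ordered eigenvalue vector of a real symmetric matrix
(junk value `0` if the matrix is not symmetric). -/
def eigs {n : ℕ} (M : Matrix (Fin n) (Fin n) ℝ) : Fin n → ℝ :=
  if h : M.IsHermitian then h.eigenvalues ∘ (Tuple.sort h.eigenvalues) else 0

/-- The Hessian matrix `D²u(x)` of `u : ℝⁿ → ℝ`. -/
def hessianMatrix {n : ℕ} (u : EuclideanSpace ℝ (Fin n) → ℝ) (x : EuclideanSpace ℝ (Fin n)) :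
    Matrix (Fin n) (Fin n) ℝ :=
  fun i j =>
    fderiv ℝ (fun y => fderiv ℝ u y (EuclideanSpace.single j 1)) x (EuclideanSpace.single i 1)

/-- The quadratic form `½ xᵀ A x`. -/
def quadForm {n : ℕ} (A : Matrix (Fin n) (Fin n) ℝ) (x : EuclideanSpace ℝ (Fin n)) : ℝ :=
  (1 / 2) * ∑ i, ∑ j, A i j * x i * x j

/-- The Gårding cone `Γ_k = {λ : σ_j(λ) > 0, 1 ≤ j ≤ k}`. -/
def GammaK (n k : ℕ) : Set (Fin n → ℝ) :=
  {lam | ∀ j, 1 ≤ j → j ≤ k → 0 < esym n j lam}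

/-- The Hessian quotient operator `S_{k,l}(M) = σ_k(λ(M))/σ_l(λ(M))`. -/
def Skl (n k l : ℕ) (M : Matrix (Fin n) (Fin n) ℝ) : ℝ :=
  esym n k (eigs M) / esym n l (eigs M)

/-- `H_k(A) = max_i σ_{k-1;i}(λ(A)) λ_i(A) / σ_k(λ(A))`. -/
def Hk (n k : ℕ) (A : Matrix (Fin n) (Fin n) ℝ) : ℝ :=
  ⨆ i : Fin n, esymRem n (k - 1) (eigs A) i * eigs A i / esym n k (eigs A)

/-- `ψ` is admissible on the open set `A` with respect to the cone `Γ`: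
it is `C²` on `A` and `λ(D²ψ) ∈ Γ` there. -/
def Admissible {n : ℕ} (Γ : Set (Fin n → ℝ)) (A : Set (EuclideanSpace ℝ (Fin n)))
    (ψ : EuclideanSpace ℝ (Fin n) → ℝ) : Prop :=
  ContDiffOn ℝ 2 ψ A ∧ ∀ x ∈ A, eigs (hessianMatrix ψ x) ∈ Γ

/-- Viscosity subsolution of `F(D²u) = g` on `Ω` (for `F` of the form `f(λ(D²u))`). -/
def ViscSubsolution {n : ℕ} (Γ : Set (Fin n → ℝ)) (F : Matrix (Fin n) (Fin n) ℝ → ℝ)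
    (g : EuclideanSpace ℝ (Fin n) → ℝ) (Ω : Set (EuclideanSpace ℝ (Fin n)))
    (u : EuclideanSpace ℝ (Fin n) → ℝ) : Prop :=
  UpperSemicontinuousOn u Ω ∧
    ∀ Aset : Set (EuclideanSpace ℝ (Fin n)), Aset ⊆ Ω → IsOpen Aset →
      ∀ ψ : EuclideanSpace ℝ (Fin n) → ℝ, Admissible Γ Aset ψ →
        ∀ x₀ ∈ Aset, IsLocalMaxOn (fun y => u y - ψ y) Aset x₀ →
          g x₀ ≤ F (hessianMatrix ψ x₀)

/-- Viscosity supersolution of `F(D²u) = g` on `Ω`. -/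
def ViscSupersolution {n : ℕ} (Γ : Set (Fin n → ℝ)) (F : Matrix (Fin n) (Fin n) ℝ → ℝ)
    (g : EuclideanSpace ℝ (Fin n) → ℝ) (Ω : Set (EuclideanSpace ℝ (Fin n)))
    (u : EuclideanSpace ℝ (Fin n) → ℝ) : Prop :=
  LowerSemicontinuousOn u Ω ∧
    ∀ Aset : Set (EuclideanSpace ℝ (Fin n)), Aset ⊆ Ω → IsOpen Aset →
      ∀ ψ : EuclideanSpace ℝ (Fin n) → ℝ, Admissible Γ Aset ψ →
        ∀ x₀ ∈ Aset, IsLocalMinOn (fun y => u y - ψ y) Aset x₀ →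
          F (hessianMatrix ψ x₀) ≤ g x₀

end

/-- `ḡ(t) = 1 + C₀ t^{-β/2}`. -/
noncomputable def gbar (C₀ β t : ℝ) : ℝ := 1 + C₀ * t ^ (-β / 2)

/-- `W(s) = ( s^{-ℋ} ( ∫₁ˢ ℋ t^{ℋ-1} ḡ(t) dt + c₁ ) )^{1/m}`. -/
noncomputable def Wsub (m : ℕ) (Hc C₀ β c₁ : ℝ) (s : ℝ) : ℝ :=
  (s ^ (-Hc) * ((∫ t in (1:ℝ)..s, Hc * t ^ (Hc - 1) * gbar C₀ β t) + c₁)) ^ ((1 : ℝ) / m)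

/-- `w(s) = c₂ + ∫_{s₀}^s W(η) dη`. -/
noncomputable def wProfile (m : ℕ) (Hc C₀ β c₁ c₂ s₀ : ℝ) (s : ℝ) : ℝ :=
  c₂ + ∫ η in s₀..s, Wsub m Hc C₀ β c₁ η

/-- The generalized symmetric function `w_{c₁,c₂}(x) = w(½xᵀAx)`. -/
noncomputable def wGSym (n : ℕ) (m : ℕ) (Hc C₀ β c₁ c₂ s₀ : ℝ)
    (A : Matrix (Fin n) (Fin n) ℝ) (x : EuclideanSpace ℝ (Fin n)) : ℝ :=
  wProfile m Hc C₀ β c₁ c₂ s₀ (quadForm A x)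

/-- The generating polynomial `∏ᵢ (1 + λᵢ X)` of the elementary symmetric functions. -/
noncomputable def genPoly {n : ℕ} (lam : Fin n → ℝ) : Polynomial ℝ :=
  ∏ i, (1 + Polynomial.C (lam i) * Polynomial.X)

theorem coeff_genPoly {n : ℕ} (lam : Fin n → ℝ) (j : ℕ) :
    (genPoly lam).coeff j = esym n j lam := by
  unfold genPoly esym
  rw [Finset.prod_one_add, Polynomial.finsetSum_coeff, Finset.powersetCard_eq_filter,
    Finset.sum_filter]
  refine Finset.sum_congr rfl fun S _ => ?_
  rw [Finset.prod_mul_distrib, Finset.prod_const, ← map_prod, Polynomial.coeff_C_mul,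
    Polynomial.coeff_X_pow]
  by_cases h : S.card = j
  · simp [h]
  · simp [h, Ne.symm h]

theorem eval_genPoly {n : ℕ} (lam : Fin n → ℝ) (t : ℝ) :
    (genPoly lam).eval t = ∏ i, (1 + lam i * t) := by
  simp [genPoly, Polynomial.eval_prod]

theorem genPoly_update_zero {n : ℕ} (lam : Fin n → ℝ) (i : Fin n) :
    genPoly (Function.update lam i 0) =
      ∏ j ∈ Finset.univ.erase i, (1 + Polynomial.C (lam j) * Polynomial.X) := by
  unfold genPoly
  rw [← Finset.mul_prod_erase _ _ (Finset.mem_univ i)]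
  simp only [Function.update_self, map_zero, zero_mul, add_zero, one_mul]
  refine Finset.prod_congr rfl fun j hj => ?_
  rw [Function.update_of_ne (Finset.ne_of_mem_erase hj)]

theorem genPoly_eq_mul {n : ℕ} (lam : Fin n → ℝ) (i : Fin n) :
    genPoly lam = (1 + Polynomial.C (lam i) * Polynomial.X) *
      genPoly (Function.update lam i 0) := by
  rw [genPoly_update_zero, genPoly]
  exact (Finset.mul_prod_erase _ (fun j => 1 + Polynomial.C (lam j) * Polynomial.X)
    (Finset.mem_univ i)).symm

theorem esym_zero {n : ℕ} (lam : Fin n → ℝ) : esym n 0 lam = 1 := by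
  simp [esym]

theorem esym_succ {n : ℕ} (lam : Fin n → ℝ) (i : Fin n) (j : ℕ) :
    esym n (j + 1) lam = esymRem n (j + 1) lam i + lam i * esymRem n j lam i := by
  rw [← coeff_genPoly, genPoly_eq_mul lam i]
  unfold esymRem
  rw [← coeff_genPoly, ← coeff_genPoly, add_mul, one_mul, Polynomial.coeff_add, mul_assoc,
    Polynomial.coeff_C_mul, Polynomial.coeff_X_mul]

theorem esym_const_mul {n : ℕ} (lam : Fin n → ℝ) (c : ℝ) (j : ℕ) :
    esym n j (fun i => c * lam i) = c ^ j * esym n j lam := by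
  unfold esym
  rw [Finset.mul_sum]
  refine Finset.sum_congr rfl fun S hS => ?_
  rw [Finset.prod_mul_distrib, Finset.prod_const, (Finset.mem_powersetCard.1 hS).2]

theorem esymRem_const_mul {n : ℕ} (lam : Fin n → ℝ) (c : ℝ) (j : ℕ) (i : Fin n) :
    esymRem n j (fun i => c * lam i) i = c ^ j * esymRem n j lam i := by
  unfold esymRem
  rw [← esym_const_mul]
  congr 1
  funext p
  by_cases h : p = i
  · subst h; simp
  · simp [h]

theorem esym_nonneg {n : ℕ} {lam : Fin n → ℝ} (h : ∀ i, 0 ≤ lam i) (j : ℕ) :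
    0 ≤ esym n j lam :=
  Finset.sum_nonneg fun _ _ => Finset.prod_nonneg fun i _ => h i

theorem esym_pos {n : ℕ} {lam : Fin n → ℝ} (h : ∀ i, 0 < lam i) {j : ℕ} (hj : j ≤ n) :
    0 < esym n j lam := by
  refine Finset.sum_pos (fun _ _ => Finset.prod_pos fun i _ => h i) ?_
  exact Finset.powersetCard_nonempty.2 (by simpa using hj)

theorem update_zero_nonneg {n : ℕ} {lam : Fin n → ℝ} (h : ∀ i, 0 < lam i) (i : Fin n) :
    ∀ p, 0 ≤ Function.update lam i 0 p := by
  intro p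
  by_cases hp : p = i
  · subst hp; simp
  · simpa [hp] using (h p).le

theorem esymRem_nonneg {n : ℕ} {lam : Fin n → ℝ} (h : ∀ i, 0 < lam i) (j : ℕ) (i : Fin n) :
    0 ≤ esymRem n j lam i :=
  esym_nonneg (update_zero_nonneg h i) j

theorem esymRem_pos {n : ℕ} {lam : Fin n → ℝ} (h : ∀ i, 0 < lam i) {j : ℕ} (hj : j < n)
    (i : Fin n) : 0 < esymRem n j lam i := by
  obtain ⟨S, hS, hc⟩ := Finset.exists_subset_card_eq
    (s := Finset.univ.erase i) (n := j) (by simp; omega)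
  refine Finset.sum_pos' (fun _ _ => Finset.prod_nonneg fun p _ => update_zero_nonneg h i p)
    ⟨S, Finset.mem_powersetCard.2 ⟨Finset.subset_univ _, hc⟩, Finset.prod_pos fun p hp => ?_⟩
  rw [Function.update_of_ne (Finset.ne_of_mem_erase (hS hp))]
  exact h p

/-- Log-concavity of the coefficients of a product of linear factors `1 + λᵢ X`, `λᵢ ≥ 0`. -/
theorem esym_mul_esym_succ_le {n : ℕ} {lam : Fin n → ℝ} (h : ∀ i, 0 ≤ lam i) {i j : ℕ}
    (hij : i ≤ j) : esym n i lam * esym n (j + 1) lam ≤ esym n (i + 1) lam * esym n j lam := by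
  have key : ∀ s : Finset (Fin n),
      (∀ j, 0 ≤ (∏ i ∈ s, (1 + Polynomial.C (lam i) * Polynomial.X)).coeff j) ∧
      ∀ i j, i ≤ j → (∏ i ∈ s, (1 + Polynomial.C (lam i) * Polynomial.X)).coeff i *
        (∏ i ∈ s, (1 + Polynomial.C (lam i) * Polynomial.X)).coeff (j + 1) ≤
        (∏ i ∈ s, (1 + Polynomial.C (lam i) * Polynomial.X)).coeff (i + 1) *
        (∏ i ∈ s, (1 + Polynomial.C (lam i) * Polynomial.X)).coeff j := by
    intro s
    induction s using Finset.induction_on with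
    | empty =>
      refine ⟨fun j => ?_, fun i j _ => ?_⟩
      · simp only [Finset.prod_empty, Polynomial.coeff_one]
        split_ifs <;> norm_num
      · simp [Polynomial.coeff_one]
    | insert b s hb ih =>
      rw [Finset.prod_insert hb]
      generalize (∏ i ∈ s, (1 + Polynomial.C (lam i) * Polynomial.X)) = p at ih
      obtain ⟨hp, hl⟩ := ih
      have hx := h b
      generalize lam b = x at hx
      have h0 : ((1 + Polynomial.C x * Polynomial.X) * p).coeff 0 = p.coeff 0 := by
        simp [add_mul, mul_assoc]
      have hs : ∀ j, ((1 + Polynomial.C x * Polynomial.X) * p).coeff (j + 1) =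
          p.coeff (j + 1) + x * p.coeff j := by
        intro j
        rw [add_mul, one_mul, Polynomial.coeff_add, mul_assoc,
          Polynomial.coeff_C_mul, Polynomial.coeff_X_mul]
      refine ⟨fun j => ?_, fun i j hij => ?_⟩
      · cases j with
        | zero => rw [h0]; exact hp 0
        | succ j => rw [hs]; exact add_nonneg (hp _) (mul_nonneg hx (hp _))
      · rcases hij.eq_or_lt with rfl | hlt
        · rw [mul_comm]
        obtain ⟨j, rfl⟩ : ∃ q, j = q + 1 := ⟨j - 1, by omega⟩
        have h1 := hl i (j + 1) hij
        cases i with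
        | zero =>
          rw [h0, hs, hs, hs]
          nlinarith [hp 0, hp 1, hp j, hp (j + 1), mul_nonneg hx (mul_nonneg (hp 1) (hp j)),
            mul_nonneg hx (mul_nonneg hx (mul_nonneg (hp 0) (hp j)))]
        | succ i =>
          rw [hs, hs, hs, hs]
          have h2 := hl i j (by omega)
          have h3 := hl i (j + 1) (by omega)
          have h4 := hl (i + 1) j (by omega)
          have h5 := mul_le_mul_of_nonneg_left (h3.trans h4) hx
          have h6 := mul_le_mul_of_nonneg_left h2 (mul_nonneg hx hx)
          nlinarith
  have := (key Finset.univ).2 i j hij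
  simpa only [← coeff_genPoly, genPoly] using this

/-- If `σ_{k-1;i} λᵢ / σ_k ≤ H` then `σ_{j-1;i} λᵢ / σ_j ≤ H` for all `j ≤ k`. -/
theorem esymRem_mul_le {n : ℕ} {lam : Fin n → ℝ} (h : ∀ i, 0 < lam i) {j k : ℕ}
    (hjk : j ≤ k) (hkn : k < n) (i : Fin n) {H : ℝ}
    (hH : esymRem n k lam i * lam i ≤ H * esym n (k + 1) lam) :
    esymRem n j lam i * lam i ≤ H * esym n (j + 1) lam := by
  rw [esym_succ lam i] at hH ⊢
  have hl : esymRem n j lam i * esymRem n (k + 1) lam i ≤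
      esymRem n (j + 1) lam i * esymRem n k lam i :=
    esym_mul_esym_succ_le (update_zero_nonneg h i) hjk
  have hk : 0 < esymRem n k lam i := esymRem_pos h hkn i
  have hj : 0 ≤ esymRem n j lam i := esymRem_nonneg h j i
  have hk1 : 0 ≤ esymRem n (k + 1) lam i := esymRem_nonneg h (k + 1) i
  have hH0 : 0 ≤ H := by
    by_contra hneg
    push Not at hneg
    nlinarith [mul_pos (h i) hk, mul_pos_of_neg_of_neg hneg (neg_neg_of_pos (mul_pos (h i) hk)),
      mul_nonneg (neg_nonneg.2 hneg.le) hk1]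
  refine le_of_mul_le_mul_right ?_ hk
  have h1 := mul_le_mul_of_nonneg_left hH hj
  have h2 := mul_le_mul_of_nonneg_left hl hH0
  nlinarith

theorem eval_genPoly_eigs {n : ℕ} {M : Matrix (Fin n) (Fin n) ℝ} (hM : M.IsHermitian)
    {t : ℝ} (ht : t ≠ 0) : (genPoly (eigs M)).eval t = (1 + t • M).det := by
  have h1 : (genPoly (eigs M)).eval t = ∏ i, (1 + hM.eigenvalues i * t) := by
    rw [eval_genPoly, eigs, dif_pos hM]
    exact Equiv.prod_comp (Tuple.sort hM.eigenvalues) (fun i => 1 + hM.eigenvalues i * t)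
  have h2 : (1 + t • M) = (-t) • (Matrix.scalar (Fin n) (-t⁻¹) - M) := by
    rw [smul_sub, neg_smul, neg_smul, sub_neg_eq_add]
    congr 1
    ext i j
    by_cases hij : i = j
    · subst hij; simp [ht]
    · simp [hij]
  rw [h1, h2, Matrix.det_smul, ← Matrix.eval_charpoly, hM.charpoly_eq, Polynomial.eval_prod,
    Fintype.card_fin]
  rw [show (-t) ^ n = ∏ _i : Fin n, (-t) by simp, ← Finset.prod_mul_distrib]
  refine Finset.prod_congr rfl fun i _ => ?_
  simp
  field_simp
  ring

theorem genPoly_eigs_eq {n : ℕ} {M : Matrix (Fin n) (Fin n) ℝ} (hM : M.IsHermitian)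
    {p : Polynomial ℝ} (hp : ∀ t, 0 < t → (1 + t • M).det = p.eval t) :
    genPoly (eigs M) = p := by
  refine Polynomial.eq_of_infinite_eval_eq _ _ ((Set.Ioi_infinite (0 : ℝ)).mono fun t ht => ?_)
  exact (eval_genPoly_eigs hM (ne_of_gt ht)).trans (hp t ht)

theorem genPoly_eigs_diagonal {n : ℕ} (a : Fin n → ℝ) :
    genPoly (eigs (Matrix.diagonal a)) = genPoly a := by
  refine genPoly_eigs_eq (Matrix.isHermitian_diagonal a) fun t _ => ?_
  rw [eval_genPoly, ← Matrix.diagonal_one, ← Matrix.diagonal_smul, Matrix.diagonal_add,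
    Matrix.det_diagonal]
  simp [mul_comm]

theorem esym_eigs_diagonal {n : ℕ} (a : Fin n → ℝ) (j : ℕ) :
    esym n j (eigs (Matrix.diagonal a)) = esym n j a := by
  rw [← coeff_genPoly, genPoly_eigs_diagonal, coeff_genPoly]

theorem esymRem_congr {n : ℕ} {lam mu : Fin n → ℝ} (h : ∀ j, esym n j lam = esym n j mu)
    {i i' : Fin n} (hi : lam i = mu i') (j : ℕ) : esymRem n j lam i = esymRem n j mu i' := by
  induction j with
  | zero => simp [esymRem, esym_zero]
  | succ j ih =>
    have h1 := h (j + 1)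
    rw [esym_succ lam i, esym_succ mu i', ih, hi] at h1
    linarith

theorem exists_eigs_diagonal_eq {n : ℕ} {a : Fin n → ℝ} {i : Fin n} (hi : a i ≠ 0) :
    ∃ i', eigs (Matrix.diagonal a) i' = a i := by
  have h : (genPoly a).eval (-(a i)⁻¹) = 0 := by
    rw [eval_genPoly]
    exact Finset.prod_eq_zero (Finset.mem_univ i) (by field_simp; ring)
  rw [← genPoly_eigs_diagonal, eval_genPoly, Finset.prod_eq_zero_iff] at h
  obtain ⟨i', -, h'⟩ := h
  refine ⟨i', ?_⟩
  field_simp at h'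
  linarith

theorem esymRem_mul_le_Hk {n : ℕ} {a : Fin n → ℝ} (ha : ∀ i, 0 < a i) {k : ℕ} (hk : k ≤ n)
    (i : Fin n) :
    esymRem n (k - 1) a i * a i ≤ Hk n k (Matrix.diagonal a) * esym n k a := by
  rw [← div_le_iff₀ (esym_pos ha hk)]
  obtain ⟨i', hi'⟩ := exists_eigs_diagonal_eq (ha i).ne'
  have h1 := le_ciSup (f := fun i : Fin n => esymRem n (k - 1) (eigs (Matrix.diagonal a)) i *
    eigs (Matrix.diagonal a) i / esym n k (eigs (Matrix.diagonal a)))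
    (Set.finite_range _).bddAbove i'
  rw [hi', esym_eigs_diagonal, esymRem_congr (esym_eigs_diagonal a) hi'] at h1
  simpa only [Hk, esym_eigs_diagonal] using h1

theorem det_diagonal_add_rank_one {n : ℕ} {e : Fin n → ℝ} (he : ∀ i, e i ≠ 0) (c : ℝ)
    (u : Fin n → ℝ) :
    (Matrix.diagonal e + c • Matrix.vecMulVec u u).det =
      ∏ i, e i + c * ∑ i, u i ^ 2 * ∏ j ∈ Finset.univ.erase i, e j := by
  have h1 : Matrix.diagonal e + c • Matrix.vecMulVec u u = Matrix.diagonal e *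
      (1 + Matrix.replicateCol Unit (fun i => (e i)⁻¹ * (c * u i)) *
        Matrix.replicateRow Unit u) := by
    ext i j
    have := he i
    rw [Matrix.diagonal_mul]
    by_cases hij : i = j
    · subst hij
      simp [Matrix.mul_apply, Matrix.vecMulVec_apply]
      field_simp
    · simp [Matrix.mul_apply, Matrix.vecMulVec_apply, hij]
      field_simp
  rw [h1, Matrix.det_mul, Matrix.det_diagonal, Matrix.det_one_add_replicateCol_mul_replicateRow,
    mul_add, mul_one, dotProduct, Finset.mul_sum, Finset.mul_sum]
  congr 1
  refine Finset.sum_congr rfl fun i _ => ?_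
  rw [← Finset.mul_prod_erase _ _ (Finset.mem_univ i)]
  have := he i
  field_simp

/-- Elementary symmetric functions of the eigenvalues of a rank-one perturbation of a diagonal
matrix. -/
theorem esym_eigs_rank_one {n : ℕ} {d : Fin n → ℝ} (hd : ∀ i, 0 < d i) (c : ℝ)
    (u : Fin n → ℝ) (j : ℕ) :
    esym n (j + 1) (eigs (Matrix.diagonal d + c • Matrix.vecMulVec u u)) =
      esym n (j + 1) d + c * ∑ i, u i ^ 2 * esymRem n j d i := by
  have hH : (Matrix.diagonal d + c • Matrix.vecMulVec u u).IsHermitian := by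
    refine Matrix.IsHermitian.ext fun i j => ?_
    by_cases hij : i = j
    · subst hij; simp
    · simp [Matrix.vecMulVec_apply, hij, Ne.symm hij, mul_comm]
  have hp := genPoly_eigs_eq hH (p := genPoly d + Polynomial.X * (Polynomial.C c *
      ∑ i, Polynomial.C (u i ^ 2) * genPoly (Function.update d i 0))) (fun t ht => by
    have h1 : 1 + t • (Matrix.diagonal d + c • Matrix.vecMulVec u u) =
        Matrix.diagonal (fun i => 1 + d i * t) + (t * c) • Matrix.vecMulVec u u := by
      rw [smul_add, ← add_assoc, smul_smul]
      congr 1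
      rw [← Matrix.diagonal_one, ← Matrix.diagonal_smul, Matrix.diagonal_add]
      simp [mul_comm]
    rw [h1, det_diagonal_add_rank_one (fun i => by have := mul_pos (hd i) ht; positivity)]
    simp only [Polynomial.eval_add, Polynomial.eval_mul, Polynomial.eval_X, Polynomial.eval_C,
      eval_genPoly, Polynomial.eval_finsetSum, genPoly_update_zero, Polynomial.eval_prod,
      Polynomial.eval_one, mul_assoc])
  rw [← coeff_genPoly, hp, Polynomial.coeff_add, Polynomial.coeff_X_mul, Polynomial.coeff_C_mul,
    Polynomial.finsetSum_coeff, coeff_genPoly]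
  simp only [Polynomial.coeff_C_mul, coeff_genPoly, esymRem]

theorem intervalIntegral_rpow_facts (q : ℝ) {s : ℝ} (hs : 1 ≤ s) :
    0 ≤ ∫ t in (1:ℝ)..s, t ^ (q - 1) ∧ q * ∫ t in (1:ℝ)..s, t ^ (q - 1) = s ^ q - 1 := by
  constructor
  · refine intervalIntegral.integral_nonneg hs fun t ht => ?_
    have : 0 ≤ t := by linarith [ht.1]
    positivity
  · rcases eq_or_ne q 0 with rfl | hq
    · simp
    · rw [integral_rpow (Or.inr ⟨by contrapose! hq; linarith, by
        rw [Set.uIcc_of_le hs]; simp⟩)]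
      simp
      field_simp

theorem continuousOn_Wsub_integrand (Hc C₀ β : ℝ) :
    ContinuousOn (fun t => Hc * t ^ (Hc - 1) * gbar C₀ β t) (Set.Ioi 0) := by
  unfold gbar
  have h : ∀ p : ℝ, ContinuousOn (fun t : ℝ => t ^ p) (Set.Ioi 0) := fun p t ht =>
    (Real.continuousAt_rpow_const t p (Or.inl (ne_of_gt ht))).continuousWithinAt
  exact (continuousOn_const.mul (h _)).mul (continuousOn_const.add (continuousOn_const.mul (h _)))

theorem intervalIntegrable_of_continuousOn_Ioi {f : ℝ → ℝ} {c x y : ℝ}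
    (hf : ContinuousOn f (Set.Ioi c)) (hx : c < x) (hy : c < y) :
    IntervalIntegrable f volume x y :=
  (hf.mono fun _ ht => lt_of_lt_of_le (lt_min hx hy) ht.1).intervalIntegrable

theorem hasDerivAt_integral_of_continuousOn_Ioi {f : ℝ → ℝ} {c x y : ℝ}
    (hf : ContinuousOn f (Set.Ioi c)) (hx : c < x) (hy : c < y) :
    HasDerivAt (fun s => ∫ t in x..s, f t) (f y) y :=
  intervalIntegral.integral_hasDerivAt_right (intervalIntegrable_of_continuousOn_Ioi hf hx hy)
    (hf.stronglyMeasurableAtFilter isOpen_Ioi y hy) (hf.continuousAt (Ioi_mem_nhds hy))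

/-- The `m`-th power of `Wsub`. -/
noncomputable def Psub (Hc C₀ β c₁ : ℝ) (s : ℝ) : ℝ :=
  s ^ (-Hc) * ((∫ t in (1:ℝ)..s, Hc * t ^ (Hc - 1) * gbar C₀ β t) + c₁)

theorem hasDerivAt_Psub (Hc C₀ β c₁ : ℝ) {s : ℝ} (hs : 0 < s) :
    HasDerivAt (Psub Hc C₀ β c₁) (Hc * (gbar C₀ β s - Psub Hc C₀ β c₁ s) / s) s := by
  have h1 := (hasDerivAt_integral_of_continuousOn_Ioi
    (continuousOn_Wsub_integrand Hc C₀ β) one_pos hs).add_const c₁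
  have h2 := (Real.hasDerivAt_rpow_const (x := s) (p := -Hc) (Or.inl hs.ne')).mul h1
  refine h2.congr_deriv ?_
  unfold Psub
  have e1 : s ^ (-Hc - 1) = s ^ (-Hc) / s := by rw [Real.rpow_sub_one hs.ne']
  have e2 : s ^ (Hc - 1) = s ^ Hc / s := by rw [Real.rpow_sub_one hs.ne']
  have e3 : s ^ (-Hc) * s ^ Hc = 1 := by rw [← Real.rpow_add hs]; simp
  rw [e1, e2]
  field_simp
  linear_combination Hc * gbar C₀ β s * e3

theorem Psub_eq (Hc C₀ β c₁ : ℝ) {s : ℝ} (hs : 1 ≤ s) :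
    Psub Hc C₀ β c₁ s = 1 + s ^ (-Hc) *
      (c₁ - 1 + C₀ * Hc * ∫ t in (1:ℝ)..s, t ^ (Hc - β / 2 - 1)) := by
  have hs0 : 0 < s := by linarith
  have hc : ∀ p : ℝ, IntervalIntegrable (fun t : ℝ => t ^ p) volume 1 s := fun p =>
    intervalIntegrable_of_continuousOn_Ioi (c := 0) (fun t ht =>
    (Real.continuousAt_rpow_const t p (Or.inl (ne_of_gt ht))).continuousWithinAt) one_pos hs0
  have h1 : ∫ t in (1:ℝ)..s, Hc * t ^ (Hc - 1) * gbar C₀ β t =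
      ∫ t in (1:ℝ)..s, (Hc * t ^ (Hc - 1) + C₀ * Hc * t ^ (Hc - β / 2 - 1)) := by
    refine intervalIntegral.integral_congr fun t ht => ?_
    rw [Set.uIcc_of_le hs] at ht
    have ht0 : 0 < t := by linarith [ht.1]
    have : t ^ (Hc - β / 2 - 1) = t ^ (Hc - 1) * t ^ (-β / 2) := by
      rw [← Real.rpow_add ht0]; ring_nf
    simp only [gbar, this]
    ring
  have h2 := (intervalIntegral_rpow_facts Hc hs).2
  rw [Psub, h1, intervalIntegral.integral_add ((hc _).const_mul _) ((hc _).const_mul _),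
    intervalIntegral.integral_const_mul, intervalIntegral.integral_const_mul, h2]
  have e3 : s ^ (-Hc) * s ^ Hc = 1 := by rw [← Real.rpow_add hs0]; simp
  linear_combination e3

theorem gbar_le_Psub {Hc C₀ β c₁ : ℝ} (hC : 0 ≤ C₀) (hβ : 0 ≤ β)
    (hc : 1 + C₀ ≤ c₁) {s : ℝ} (hs : 1 ≤ s) : gbar C₀ β s ≤ Psub Hc C₀ β c₁ s := by
  have hs0 : 0 < s := by linarith
  rw [Psub_eq Hc C₀ β c₁ hs, gbar]
  obtain ⟨hJ, hq⟩ := intervalIntegral_rpow_facts (Hc - β / 2) hs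
  set J := ∫ t in (1:ℝ)..s, t ^ (Hc - β / 2 - 1)
  have e : s ^ (-β / 2) = s ^ (-Hc) * s ^ (Hc - β / 2) := by
    rw [← Real.rpow_add hs0]; ring_nf
  have e2 : s ^ (Hc - β / 2) = 1 + (Hc - β / 2) * J := by linarith
  rw [e, e2]
  have h3 : C₀ * (1 + (Hc - β / 2) * J) ≤ c₁ - 1 + C₀ * Hc * J := by
    have : 0 ≤ C₀ * (β / 2) * J := by positivity
    nlinarith
  have := mul_le_mul_of_nonneg_left h3 (Real.rpow_nonneg hs0.le (-Hc))
  linarith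

theorem Wsub_eq (m : ℕ) (Hc C₀ β c₁ s : ℝ) :
    Wsub m Hc C₀ β c₁ s = Psub Hc C₀ β c₁ s ^ ((1 : ℝ) / m) := rfl

section Profile

variable {m : ℕ} {Hc C₀ β c₁ : ℝ}

theorem one_le_Psub (hC : 0 ≤ C₀) (hβ : 0 ≤ β)
    (hc : 1 + C₀ ≤ c₁) {s : ℝ} (hs : 1 ≤ s) : 1 ≤ Psub Hc C₀ β c₁ s := by
  refine le_trans ?_ (gbar_le_Psub hC hβ hc hs)
  have : 0 ≤ s ^ (-β / 2) := Real.rpow_nonneg (by linarith) _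
  unfold gbar
  nlinarith [mul_nonneg hC this]

theorem one_le_Wsub (hC : 0 ≤ C₀) (hβ : 0 ≤ β)
    (hc : 1 + C₀ ≤ c₁) {s : ℝ} (hs : 1 ≤ s) : 1 ≤ Wsub m Hc C₀ β c₁ s := by
  rw [Wsub_eq]
  exact Real.one_le_rpow (one_le_Psub hC hβ hc hs) (by positivity)

theorem Wsub_le_Psub (hm : 1 ≤ m) (hC : 0 ≤ C₀) (hβ : 0 ≤ β)
    (hc : 1 + C₀ ≤ c₁) {s : ℝ} (hs : 1 ≤ s) :
    Wsub m Hc C₀ β c₁ s ≤ Psub Hc C₀ β c₁ s := by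
  rw [Wsub_eq]
  have h := one_le_Psub (Hc := Hc) hC hβ hc hs
  calc _ ≤ Psub Hc C₀ β c₁ s ^ (1 : ℝ) := by
        refine Real.rpow_le_rpow_of_exponent_le h ?_
        rw [div_le_one (by positivity)]
        exact_mod_cast hm
    _ = _ := Real.rpow_one _

theorem Wsub_pow (hm : 1 ≤ m) (hC : 0 ≤ C₀) (hβ : 0 ≤ β)
    (hc : 1 + C₀ ≤ c₁) {s : ℝ} (hs : 1 ≤ s) :
    Wsub m Hc C₀ β c₁ s ^ m = Psub Hc C₀ β c₁ s := by
  rw [Wsub_eq, one_div]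
  exact Real.rpow_inv_natCast_pow (by linarith [one_le_Psub (Hc := Hc) hC hβ hc hs]) (by omega)

theorem exists_hasDerivAt_Wsub (hm : 1 ≤ m) (hH : 0 < Hc) (hC : 0 ≤ C₀) (hβ : 0 ≤ β)
    (hc : 1 + C₀ ≤ c₁) {s : ℝ} (hs : 1 < s) :
    ∃ W' : ℝ, HasDerivAt (Wsub m Hc C₀ β c₁) W' s ∧ W' ≤ 0 ∧
      m * Wsub m Hc C₀ β c₁ s ^ (m - 1) * W' =
        Hc * (gbar C₀ β s - Wsub m Hc C₀ β c₁ s ^ m) / s := by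
  have hs0 : 0 < s := by linarith
  have hP := hasDerivAt_Psub Hc C₀ β c₁ hs0
  have hP1 := one_le_Psub (Hc := Hc) hC hβ hc hs.le
  have hW : HasDerivAt (Wsub m Hc C₀ β c₁) _ s :=
    hP.rpow_const (p := (1 : ℝ) / m) (Or.inl (by linarith))
  refine ⟨_, hW, ?_, ?_⟩
  · have h1 : Hc * (gbar C₀ β s - Psub Hc C₀ β c₁ s) / s ≤ 0 :=
      div_nonpos_of_nonpos_of_nonneg
        (mul_nonpos_of_nonneg_of_nonpos hH.le (by linarith [gbar_le_Psub (Hc := Hc) hC hβ hc hs.le]))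
        hs0.le
    have h2 : 0 ≤ Psub Hc C₀ β c₁ s ^ ((1 : ℝ) / m - 1) := Real.rpow_nonneg (by linarith) _
    exact mul_nonpos_of_nonpos_of_nonneg (mul_nonpos_of_nonpos_of_nonneg h1 (by positivity)) h2
  · rw [Wsub_pow hm hC hβ hc hs.le]
    refine (hW.pow m).unique (hP.congr_of_eventuallyEq ?_)
    filter_upwards [Ioi_mem_nhds hs] with t ht
    exact Wsub_pow hm hC hβ hc (le_of_lt ht)

theorem continuousOn_Wsub (hm : 1 ≤ m) (hH : 0 < Hc) (hC : 0 ≤ C₀) (hβ : 0 ≤ β)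
    (hc : 1 + C₀ ≤ c₁) : ContinuousOn (Wsub m Hc C₀ β c₁) (Set.Ioi 1) := fun _ hs =>
  let ⟨_, h, _⟩ := exists_hasDerivAt_Wsub hm hH hC hβ hc hs
  h.continuousAt.continuousWithinAt

theorem hasDerivAt_wProfile (hm : 1 ≤ m) (hH : 0 < Hc) (hC : 0 ≤ C₀) (hβ : 0 ≤ β)
    (hc : 1 + C₀ ≤ c₁) (c₂ : ℝ) {s₀ s : ℝ} (hs₀ : 1 < s₀) (hs : 1 < s) :
    HasDerivAt (wProfile m Hc C₀ β c₁ c₂ s₀) (Wsub m Hc C₀ β c₁ s) s :=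
  (hasDerivAt_integral_of_continuousOn_Ioi
    (continuousOn_Wsub hm hH hC hβ hc) hs₀ hs).const_add c₂

end Profile

/-- Comparison of a tail integral with an explicit primitive. -/
theorem integral_Ioi_tail_le {f phi G : ℝ → ℝ} {c : ℝ} (hf : ContinuousOn f (Set.Ioi c))
    (h0 : ∀ s, c < s → 0 ≤ f s) (hle : ∀ s, c < s → f s ≤ phi s)
    (hG : ∀ s, c < s → HasDerivAt G (-phi s) s) (hlim : Tendsto G atTop (nhds 0))
    {s : ℝ} (hs : c < s) :
    IntegrableOn f (Set.Ioi s) ∧ 0 ≤ ∫ t in Set.Ioi s, f t ∧ ∫ t in Set.Ioi s, f t ≤ G s := by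
  have hd : ∀ t ∈ Set.Ici s, HasDerivAt G (-phi t) t := fun t ht => hG t (lt_of_lt_of_le hs ht)
  have hn : ∀ t ∈ Set.Ioi s, -phi t ≤ 0 := fun t ht => by
    have := hs.trans ht
    linarith [h0 t this, hle t this]
  have hi := (integrableOn_Ioi_deriv_of_nonpos' hd hn hlim).neg
  have hv := integral_Ioi_of_hasDerivAt_of_nonpos' hd hn hlim
  rw [integral_neg] at hv
  have hphi : IntegrableOn phi (Set.Ioi s) := by
    refine hi.congr_fun (fun t _ => by simp) measurableSet_Ioi
  have hfi : IntegrableOn f (Set.Ioi s) := by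
    refine hphi.mono' ((hf.mono fun t ht => hs.trans ht).aestronglyMeasurable measurableSet_Ioi) ?_
    refine (ae_restrict_mem measurableSet_Ioi).mono fun t ht => ?_
    rw [Real.norm_of_nonneg (h0 t (hs.trans ht))]
    exact hle t (hs.trans ht)
  refine ⟨hfi, setIntegral_nonneg measurableSet_Ioi fun t ht => h0 t (hs.trans ht), ?_⟩
  have := setIntegral_mono_on hfi hphi measurableSet_Ioi fun t ht => hle t (hs.trans ht)
  linarith

section ProfileAsymptotics

variable {m : ℕ} {Hc C₀ β c₁ : ℝ}

theorem wProfile_sub_eq (hm : 1 ≤ m) (hH : 0 < Hc) (hC : 0 ≤ C₀) (hβ : 0 ≤ β)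
    (hc : 1 + C₀ ≤ c₁) (c₂ : ℝ) {s₀ s : ℝ} (hs₀ : 1 < s₀) (hs : s₀ ≤ s)
    (hi : IntegrableOn (fun η => Wsub m Hc C₀ β c₁ η - 1) (Set.Ioi s₀)) :
    wProfile m Hc C₀ β c₁ c₂ s₀ s -
      (s + (c₂ - s₀ + ∫ η in Set.Ioi s₀, (Wsub m Hc C₀ β c₁ η - 1))) =
      -∫ η in Set.Ioi s, (Wsub m Hc C₀ β c₁ η - 1) := by
  have hsub : IntervalIntegrable (Wsub m Hc C₀ β c₁) volume s₀ s :=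
    intervalIntegrable_of_continuousOn_Ioi (continuousOn_Wsub hm hH hC hβ hc) hs₀
      (lt_of_lt_of_le hs₀ hs)
  rw [← intervalIntegral.integral_interval_add_Ioi hi (hi.mono_set (Set.Ioi_subset_Ioi hs)),
    intervalIntegral.integral_sub hsub intervalIntegrable_const, wProfile]
  simp
  ring

/-- Power decay of `Wsub - 1` in the non-resonant case. -/
theorem Wsub_sub_one_le_rpow (hm : 1 ≤ m) (hH : 0 < Hc) (hC : 0 ≤ C₀) (hβ : 0 ≤ β)
    (hc : 1 + C₀ ≤ c₁) (hne : Hc ≠ β / 2) {s : ℝ} (hs : 1 ≤ s) :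
    Wsub m Hc C₀ β c₁ s - 1 ≤
      (c₁ - 1 + C₀ * Hc / |Hc - β / 2|) * s ^ (-min (β / 2) Hc) := by
  have hs0 : 0 < s := by linarith
  have h := Wsub_le_Psub (Hc := Hc) hm hC hβ hc hs
  rw [Psub_eq Hc C₀ β c₁ hs] at h
  obtain ⟨hJ, hq⟩ := intervalIntegral_rpow_facts (Hc - β / 2) hs
  set J := ∫ t in (1:ℝ)..s, t ^ (Hc - β / 2 - 1)
  have hq0 : 0 < |Hc - β / 2| := abs_pos.2 (sub_ne_zero.2 hne)
  have hmono : s ^ (-Hc) ≤ s ^ (-min (β / 2) Hc) :=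
    Real.rpow_le_rpow_of_exponent_le hs (neg_le_neg (min_le_right _ _))
  have hsp : 0 < s ^ (-Hc) := Real.rpow_pos_of_pos hs0 _
  have hJb : s ^ (-Hc) * J ≤ 1 / |Hc - β / 2| * s ^ (-min (β / 2) Hc) := by
    rw [one_div, inv_mul_eq_div, le_div_iff₀ hq0]
    rcases lt_or_gt_of_ne hne with hlt | hgt
    · rw [min_eq_right hlt.le, abs_of_neg (by linarith)]
      have : 0 ≤ s ^ (Hc - β / 2) := Real.rpow_nonneg hs0.le _
      nlinarith
    · rw [min_eq_left hgt.le, abs_of_pos (by linarith)]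
      have e : s ^ (-(β / 2)) = s ^ (-Hc) * s ^ (Hc - β / 2) := by
        rw [← Real.rpow_add hs0]; ring_nf
      rw [e]
      nlinarith
  have h1 := mul_le_mul_of_nonneg_left hmono (show 0 ≤ c₁ - 1 by linarith)
  have h2 := mul_le_mul_of_nonneg_left hJb (show 0 ≤ C₀ * Hc by positivity)
  calc _ ≤ (c₁ - 1) * s ^ (-Hc) + C₀ * Hc * (s ^ (-Hc) * J) := by linarith
    _ ≤ _ := add_le_add h1 h2
    _ = _ := by ring

/-- Logarithmic decay of `Wsub - 1` in the resonant case. -/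
theorem Wsub_sub_one_le_log (hm : 1 ≤ m) (hC : 0 ≤ C₀) (hβ : 0 ≤ β)
    (hc : 1 + C₀ ≤ c₁) (heq : Hc = β / 2) {s : ℝ} (hs : 1 ≤ s) :
    Wsub m Hc C₀ β c₁ s - 1 ≤ s ^ (-Hc) * (c₁ - 1 + C₀ * Hc * Real.log s) := by
  have hs0 : 0 < s := by linarith
  have h := Wsub_le_Psub (Hc := Hc) hm hC hβ hc hs
  rw [Psub_eq Hc C₀ β c₁ hs] at h
  have hJ : ∫ t in (1:ℝ)..s, t ^ (Hc - β / 2 - 1) = Real.log s := by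
    have : Hc - β / 2 - 1 = -1 := by linarith
    simp only [this, Real.rpow_neg_one]
    rw [integral_inv (by rw [Set.uIcc_of_le hs]; simp)]
    simp
  rw [hJ] at h
  linarith

/-- Tail estimate in the non-resonant case. -/
theorem exists_tail_le_rpow (hm : 1 ≤ m) (hH : 1 < Hc) (hC : 0 ≤ C₀) (hβ : 2 < β)
    (hc : 1 + C₀ ≤ c₁) (hne : Hc ≠ β / 2) :
    ∃ K : ℝ, 0 ≤ K ∧ ∀ s, 1 < s →
      IntegrableOn (fun η => Wsub m Hc C₀ β c₁ η - 1) (Set.Ioi s) ∧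
      0 ≤ ∫ η in Set.Ioi s, (Wsub m Hc C₀ β c₁ η - 1) ∧
      ∫ η in Set.Ioi s, (Wsub m Hc C₀ β c₁ η - 1) ≤ K * s ^ (1 - min (β / 2) Hc) := by
  set p := min (β / 2) Hc with hp
  have hp1 : 1 < p := lt_min (by linarith) hH
  set K := c₁ - 1 + C₀ * Hc / |Hc - β / 2| with hK
  have hK0 : 0 ≤ K := by
    have : 0 ≤ C₀ * Hc / |Hc - β / 2| := by positivity
    linarith
  refine ⟨K / (p - 1), div_nonneg hK0 (by linarith), fun s hs => ?_⟩
  refine integral_Ioi_tail_le (c := 1) (phi := fun t => K * t ^ (-p))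
    (G := fun t => K / (p - 1) * t ^ (1 - p))
    ((continuousOn_Wsub hm (by linarith) hC (by linarith) hc).sub continuousOn_const)
    (fun t ht => ?_) (fun t ht => ?_) (fun t ht => ?_) ?_ hs
  · exact sub_nonneg.2 (one_le_Wsub hC (by linarith) hc ht.le)
  · exact Wsub_sub_one_le_rpow hm (by linarith) hC (by linarith) hc hne ht.le
  · have h := (Real.hasDerivAt_rpow_const (x := t) (p := 1 - p)
      (Or.inl (by linarith))).const_mul (K / (p - 1))
    refine h.congr_deriv ?_
    have e : 1 - p - 1 = -p := by ring
    have : p - 1 ≠ 0 := by linarith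
    rw [e]
    field_simp
    ring
  · have h := (tendsto_rpow_neg_atTop (show 0 < p - 1 by linarith)).const_mul (K / (p - 1))
    simpa using h

/-- Tail estimate in the resonant case. -/
theorem exists_tail_le_log (hm : 1 ≤ m) (hH : 1 < Hc) (hC : 0 ≤ C₀)
    (hc : 1 + C₀ ≤ c₁) (heq : Hc = β / 2) :
    ∃ K L : ℝ, 0 ≤ K ∧ 0 ≤ L ∧ ∀ s, 1 < s →
      IntegrableOn (fun η => Wsub m Hc C₀ β c₁ η - 1) (Set.Ioi s) ∧
      0 ≤ ∫ η in Set.Ioi s, (Wsub m Hc C₀ β c₁ η - 1) ∧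
      ∫ η in Set.Ioi s, (Wsub m Hc C₀ β c₁ η - 1) ≤
        s ^ (1 - Hc) * (K * Real.log s + L) := by
  have hH1 : 0 < Hc - 1 := by linarith
  set K := C₀ * Hc / (Hc - 1) with hK
  have hK0 : 0 ≤ K := by positivity
  set L := (c₁ - 1 + K) / (Hc - 1) with hL
  have hL0 : 0 ≤ L := div_nonneg (by linarith) hH1.le
  refine ⟨K, L, hK0, hL0, fun s hs => ?_⟩
  refine integral_Ioi_tail_le (c := 1)
    (phi := fun t => t ^ (-Hc) * (c₁ - 1 + C₀ * Hc * Real.log t))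
    (G := fun t => t ^ (1 - Hc) * (K * Real.log t + L))
    ((continuousOn_Wsub hm (by linarith) hC (by linarith) hc).sub continuousOn_const)
    (fun t ht => ?_) (fun t ht => ?_) (fun t ht => ?_) ?_ hs
  · exact sub_nonneg.2 (one_le_Wsub hC (by linarith) hc ht.le)
  · exact Wsub_sub_one_le_log hm hC (by linarith) hc heq ht.le
  · have ht0 : 0 < t := by linarith
    have h := (Real.hasDerivAt_rpow_const (x := t) (p := 1 - Hc) (Or.inl ht0.ne')).mul
      (((Real.hasDerivAt_log ht0.ne').const_mul K).add_const L)
    refine h.congr_deriv ?_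
    have e : 1 - Hc - 1 = -Hc := by ring
    have e1 : t ^ (1 - Hc) = t * t ^ (-Hc) := by
      rw [sub_eq_add_neg, Real.rpow_add ht0, Real.rpow_one]
    have eK : K * (Hc - 1) = C₀ * Hc := by rw [hK]; field_simp
    have eL : L * (Hc - 1) = c₁ - 1 + K := by rw [hL]; field_simp
    rw [e, e1, ← eK]
    field_simp
    linear_combination (-1 : ℝ) * eL
  · have h1 : Tendsto (fun t : ℝ => t ^ (1 - Hc)) atTop (nhds 0) := by
      simpa using tendsto_rpow_neg_atTop hH1
    have h2 : Tendsto (fun t : ℝ => Real.log t / t ^ (Hc - 1)) atTop (nhds 0) :=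
      (isLittleO_log_rpow_atTop hH1).tendsto_div_nhds_zero
    have h3 := (h2.const_mul K).add (h1.mul_const L)
    simp only [mul_zero, zero_mul, add_zero] at h3
    refine h3.congr' ?_
    filter_upwards [eventually_gt_atTop 0] with t ht
    have : t ^ (1 - Hc) = (t ^ (Hc - 1))⁻¹ := by rw [← Real.rpow_neg ht.le]; ring_nf
    rw [this]
    ring

end ProfileAsymptotics

theorem quadForm_diagonal {n : ℕ} (a : Fin n → ℝ) (x : EuclideanSpace ℝ (Fin n)) :
    quadForm (Matrix.diagonal a) x = (1 / 2) * ∑ i, a i * x i ^ 2 := by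
  unfold quadForm
  congr 1
  refine Finset.sum_congr rfl fun i _ => ?_
  rw [Finset.sum_eq_single i (fun j _ hj => by simp [Ne.symm hj]) (by simp)]
  simp
  ring

theorem hasFDerivAt_quadForm_diagonal {n : ℕ} (a : Fin n → ℝ) (x : EuclideanSpace ℝ (Fin n)) :
    HasFDerivAt (quadForm (Matrix.diagonal a))
      (∑ i, (a i * x i) • (EuclideanSpace.proj i : EuclideanSpace ℝ (Fin n) →L[ℝ] ℝ)) x := by
  have h : quadForm (Matrix.diagonal a) =
      fun y : EuclideanSpace ℝ (Fin n) => ∑ i, (1 / 2 * a i) * y i ^ 2 := by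
    funext y
    rw [quadForm_diagonal, Finset.mul_sum]
    simp only [mul_assoc]
  rw [h]
  refine HasFDerivAt.fun_sum fun i _ => ?_
  have h1 : HasFDerivAt (fun y : EuclideanSpace ℝ (Fin n) => y i)
      ((EuclideanSpace.proj i : EuclideanSpace ℝ (Fin n) →L[ℝ] ℝ)) x :=
    (EuclideanSpace.proj i : EuclideanSpace ℝ (Fin n) →L[ℝ] ℝ).hasFDerivAt
  refine ((h1.pow 2).const_mul (1 / 2 * a i)).congr_fderiv ?_
  ext v
  simp
  ring

/-- Hessian of a generalized symmetric function. -/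
theorem hessianMatrix_comp_quadForm {n : ℕ} (a : Fin n → ℝ) {w W : ℝ → ℝ} {W' c : ℝ}
    (x : EuclideanSpace ℝ (Fin n)) (hx : c < quadForm (Matrix.diagonal a) x)
    (hw : ∀ s, c < s → HasDerivAt w (W s) s)
    (hW : HasDerivAt W W' (quadForm (Matrix.diagonal a) x)) :
    hessianMatrix (fun y => w (quadForm (Matrix.diagonal a) y)) x =
      Matrix.diagonal (fun i => W (quadForm (Matrix.diagonal a) x) * a i) +
        W' • Matrix.vecMulVec (fun i => a i * x i) (fun i => a i * x i) := by
  have hq := hasFDerivAt_quadForm_diagonal a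
  have hL : ∀ (y : EuclideanSpace ℝ (Fin n)) (j : Fin n),
      (∑ i, (a i * y i) • (EuclideanSpace.proj i : EuclideanSpace ℝ (Fin n) →L[ℝ] ℝ))
        (EuclideanSpace.single j 1) = a j * y j := by
    intro y j
    simp
  ext i j
  have hev : (fun y => fderiv ℝ (fun y => w (quadForm (Matrix.diagonal a) y)) y
      (EuclideanSpace.single j 1)) =ᶠ[nhds x]
      fun y => W (quadForm (Matrix.diagonal a) y) * (a j * y j) := by
    filter_upwards [(hq x).continuousAt.eventually (Ioi_mem_nhds hx)] with y hy
    have h1 := (hw _ hy).comp_hasFDerivAt y (hq y)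
    have h2 : fderiv ℝ (fun y => w (quadForm (Matrix.diagonal a) y)) y = _ := h1.fderiv
    rw [h2, smul_apply, hL, smul_eq_mul]
  have h3 : HasFDerivAt (fun y : EuclideanSpace ℝ (Fin n) => a j * y j)
      (a j • (EuclideanSpace.proj j : EuclideanSpace ℝ (Fin n) →L[ℝ] ℝ)) x :=
    (EuclideanSpace.proj j : EuclideanSpace ℝ (Fin n) →L[ℝ] ℝ).hasFDerivAt.const_mul (a j)
  have h4 := (hW.comp_hasFDerivAt x (hq x)).mul h3
  have h5 : fderiv ℝ (fun y => W (quadForm (Matrix.diagonal a) y) * (a j * y j)) x = _ := h4.fderiv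
  rw [hessianMatrix, hev.fderiv_eq, h5]
  simp only [add_apply, smul_apply, hL, smul_eq_mul,
    Matrix.add_apply, Matrix.smul_apply, Matrix.vecMulVec_apply, Function.comp_apply]
  by_cases hij : i = j
  · subst hij
    simp
    ring
  · simp [hij, Ne.symm hij]
    ring

theorem exists_mul_norm_sq_le_quadForm {n : ℕ} {a : Fin n → ℝ} (ha : ∀ i, 0 < a i) (hn : 0 < n) :
    ∃ c : ℝ, 0 < c ∧ ∀ x : EuclideanSpace ℝ (Fin n),
      c * ‖x‖ ^ 2 ≤ quadForm (Matrix.diagonal a) x := by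
  have : Nonempty (Fin n) := ⟨⟨0, hn⟩⟩
  obtain ⟨i₀, hi₀⟩ := Finite.exists_min a
  refine ⟨a i₀ / 2, half_pos (ha i₀), fun x => ?_⟩
  rw [quadForm_diagonal, EuclideanSpace.real_norm_sq_eq, Finset.mul_sum, Finset.mul_sum]
  refine Finset.sum_le_sum fun i _ => ?_
  nlinarith [mul_le_mul_of_nonneg_right (hi₀ i) (sq_nonneg (x i))]

theorem quadForm_le_mul_norm_sq {n : ℕ} {a : Fin n → ℝ} (ha : ∀ i, 0 < a i)
    (x : EuclideanSpace ℝ (Fin n)) :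
    quadForm (Matrix.diagonal a) x ≤ (∑ i, a i) * ‖x‖ ^ 2 := by
  rw [quadForm_diagonal, Finset.sum_mul, Finset.mul_sum]
  refine Finset.sum_le_sum fun i _ => ?_
  have h : x i ^ 2 ≤ ‖x‖ ^ 2 := by
    rw [EuclideanSpace.real_norm_sq_eq]
    exact Finset.single_le_sum (f := fun i => x i ^ 2) (fun i _ => sq_nonneg _) (Finset.mem_univ i)
  have := mul_le_mul_of_nonneg_left h (ha i).le
  have := mul_nonneg (ha i).le (sq_nonneg (x i))
  linarith

section RankOne

variable {n : ℕ} {a : Fin n → ℝ} {W W' : ℝ}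

theorem esym_eigs_hessian (ha : ∀ i, 0 < a i) (hW : 0 < W) (x : EuclideanSpace ℝ (Fin n))
    (j : ℕ) :
    esym n (j + 1) (eigs (Matrix.diagonal (fun i => W * a i) +
      W' • Matrix.vecMulVec (fun i => a i * x i) (fun i => a i * x i))) =
      W ^ (j + 1) * esym n (j + 1) a +
        W' * (W ^ j * ∑ i, a i * x i ^ 2 * (esymRem n j a i * a i)) := by
  rw [esym_eigs_rank_one (fun i => mul_pos hW (ha i)), esym_const_mul]
  have e : ∑ i, (a i * x i) ^ 2 * esymRem n j (fun i => W * a i) i =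
      W ^ j * ∑ i, a i * x i ^ 2 * (esymRem n j a i * a i) := by
    rw [Finset.mul_sum]
    refine Finset.sum_congr rfl fun i _ => ?_
    rw [esymRem_const_mul]
    ring
  rw [e]

theorem esym_eigs_hessian_ge (ha : ∀ i, 0 < a i) (hW : 0 < W) (hW' : W' ≤ 0)
    (x : EuclideanSpace ℝ (Fin n)) {j k : ℕ} (hjk : j < k) (hkn : k ≤ n) :
    W ^ j * esym n (j + 1) a *
        (W + 2 * Hk n k (Matrix.diagonal a) * quadForm (Matrix.diagonal a) x * W') ≤
      esym n (j + 1) (eigs (Matrix.diagonal (fun i => W * a i) +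
        W' • Matrix.vecMulVec (fun i => a i * x i) (fun i => a i * x i))) := by
  rw [esym_eigs_hessian ha hW]
  obtain ⟨k, rfl⟩ : ∃ q, k = q + 1 := ⟨k - 1, by omega⟩
  set h := Hk n (k + 1) (Matrix.diagonal a)
  have h1 : ∑ i, a i * x i ^ 2 * (esymRem n j a i * a i) ≤
      2 * quadForm (Matrix.diagonal a) x * (h * esym n (j + 1) a) := by
    rw [quadForm_diagonal, ← mul_assoc (2 : ℝ), show (2 : ℝ) * (1 / 2) = 1 by norm_num, one_mul,
      Finset.sum_mul]
    refine Finset.sum_le_sum fun i _ => ?_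
    have h2 := esymRem_mul_le ha (show j ≤ k by omega) (by omega) i (esymRem_mul_le_Hk ha hkn i)
    have h3 := mul_le_mul_of_nonneg_left h2 (mul_nonneg (ha i).le (sq_nonneg (x i)))
    linarith
  have h4 := mul_le_mul_of_nonpos_left (mul_le_mul_of_nonneg_left h1 (pow_pos hW j).le) hW'
  refine le_trans (le_of_eq ?_) (add_le_add_right h4 _)
  ring

theorem esym_eigs_hessian_le (ha : ∀ i, 0 < a i) (hW : 0 < W) (hW' : W' ≤ 0)
    (x : EuclideanSpace ℝ (Fin n)) (l : ℕ) :
    esym n l (eigs (Matrix.diagonal (fun i => W * a i) +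
        W' • Matrix.vecMulVec (fun i => a i * x i) (fun i => a i * x i))) ≤
      W ^ l * esym n l a := by
  cases l with
  | zero => simp [esym_zero]
  | succ j =>
    rw [esym_eigs_hessian ha hW]
    have h1 : 0 ≤ ∑ i, a i * x i ^ 2 * (esymRem n j a i * a i) :=
      Finset.sum_nonneg fun i _ => mul_nonneg (mul_nonneg (ha i).le (sq_nonneg _))
        (mul_nonneg (esymRem_nonneg ha j i) (ha i).le)
    have h2 := mul_nonpos_of_nonpos_of_nonneg hW' (mul_nonneg (pow_pos hW j).le h1)
    linarith

/-- Admissibility and the subsolution inequality for the Hessian of a generalized symmetric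
function whose profile solves `W^m + 2 H s W^{m-1} W' = G`. -/
theorem rank_one_subsolution (ha : ∀ i, 0 < a i) {k l : ℕ} (hlk : l < k) (hkn : k ≤ n)
    (hS : esym n k a = esym n l a) (hW : 0 < W) (hW' : W' ≤ 0) (x : EuclideanSpace ℝ (Fin n))
    {G : ℝ} (hG : 0 < G)
    (hode : W ^ (k - l - 1) * (W + 2 * Hk n k (Matrix.diagonal a) *
      quadForm (Matrix.diagonal a) x * W') = G) :
    eigs (Matrix.diagonal (fun i => W * a i) +
        W' • Matrix.vecMulVec (fun i => a i * x i) (fun i => a i * x i)) ∈ GammaK n k ∧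
    G ≤ Skl n k l (Matrix.diagonal (fun i => W * a i) +
        W' • Matrix.vecMulVec (fun i => a i * x i) (fun i => a i * x i)) := by
  set T := W + 2 * Hk n k (Matrix.diagonal a) * quadForm (Matrix.diagonal a) x * W' with hT
  have hT0 : 0 < T := by
    rw [← hode] at hG
    exact (mul_pos_iff_of_pos_left (pow_pos hW _)).1 hG
  have hpos : ∀ j, j ≤ k → 0 < esym n j (eigs (Matrix.diagonal (fun i => W * a i) +
      W' • Matrix.vecMulVec (fun i => a i * x i) (fun i => a i * x i))) := by
    intro j hj
    cases j with
    | zero => simp [esym_zero]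
    | succ j =>
      exact lt_of_lt_of_le
        (mul_pos (mul_pos (pow_pos hW j) (esym_pos ha (hj.trans hkn))) hT0)
        (esym_eigs_hessian_ge ha hW hW' x hj hkn)
  refine ⟨fun j _ hj => hpos j hj, ?_⟩
  rw [Skl, le_div_iff₀ (hpos l hlk.le)]
  obtain ⟨q, rfl⟩ : ∃ q, k = q + 1 := ⟨k - 1, by omega⟩
  refine le_trans ?_ (esym_eigs_hessian_ge ha hW hW' x (Nat.lt_succ_self q) hkn)
  refine (mul_le_mul_of_nonneg_left (esym_eigs_hessian_le ha hW hW' x l) hG.le).trans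
    (le_of_eq ?_)
  have hq : W ^ q = W ^ l * W ^ (q + 1 - l - 1) := by
    rw [← pow_add]; congr 1; omega
  rw [← hT, hS, ← hode, hq]
  ring

end RankOne

theorem Hk_diagonal_pos {n : ℕ} {a : Fin n → ℝ} (ha : ∀ i, 0 < a i) {k : ℕ} (hk : 0 < k)
    (hkn : k ≤ n) : 0 < Hk n k (Matrix.diagonal a) := by
  have i : Fin n := ⟨0, by omega⟩
  have h := lt_of_lt_of_le (mul_pos (esymRem_pos ha (show k - 1 < n by omega) i) (ha i))
    (esymRem_mul_le_Hk ha hkn i)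
  exact (pos_iff_pos_of_mul_pos h).2 (esym_pos ha hkn)

theorem rpow_le_of_mul_sq_le {c r s p : ℝ} (hc : 0 < c) (hr : 0 < r) (hs : c * r ^ 2 ≤ s)
    (hp : p ≤ 0) : s ^ p ≤ c ^ p * r ^ (2 * p) := by
  have h := Real.rpow_le_rpow_of_nonpos (show 0 < c * r ^ 2 by positivity) hs hp
  rwa [Real.mul_rpow hc.le (by positivity), ← Real.rpow_natCast r 2, ← Real.rpow_mul hr.le] at h

/-- **Proposition 2.6 / `G-pro:sub`**: for diagonal `A ∈ 𝒜ˢ_{k,l}` and `g` with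
`g ≤ 1 + C₀ s^{-β/2}` for `s = ½xᵀAx ≥ s₀`, there is `C̃ > 1` such that for `c₁ > C̃` the
generalized symmetric function `w_{c₁,c₂}` is a uniformly `k`-convex subsolution of the
Hessian quotient equation on `{½xᵀAx ≥ s₀}` with quadratic asymptotics at infinity. -/
theorem gsym_subsolution
    (n k l : ℕ) (hn : 3 ≤ n) (hlk : l < k) (hkn : k ≤ n)
    (a : Fin n → ℝ) (hApd : (Matrix.diagonal a).PosDef)
    (hA1 : Skl n k l (Matrix.diagonal a) = 1)
    (hAH : Hk n k (Matrix.diagonal a) < ((k : ℝ) - l) / 2)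
    (g : EuclideanSpace ℝ (Fin n) → ℝ) (hgc : Continuous g)
    (hginf : ∃ δ : ℝ, 0 < δ ∧ ∀ x, δ ≤ g x)
    (β : ℝ) (hβ : 2 < β)
    (hgasym : ∃ C R : ℝ, ∀ x : EuclideanSpace ℝ (Fin n), R ≤ ‖x‖ → ‖x‖ ^ β * |g x - 1| ≤ C)
    (C₀ s₀ : ℝ) (hC₀ : 1 < C₀) (hs₀ : 1 < s₀)
    (hup : ∀ x : EuclideanSpace ℝ (Fin n), s₀ ≤ quadForm (Matrix.diagonal a) x →
      g x ≤ 1 + C₀ * (quadForm (Matrix.diagonal a) x) ^ (-β / 2)) :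
    ∃ Ct : ℝ, 1 < Ct ∧ ∀ c₁ : ℝ, Ct < c₁ → ∀ c₂ : ℝ,
      (∀ x : EuclideanSpace ℝ (Fin n), s₀ ≤ quadForm (Matrix.diagonal a) x →
        eigs (hessianMatrix
            (wGSym n (k - l) (((k : ℝ) - l) / (2 * Hk n k (Matrix.diagonal a))) C₀ β c₁ c₂ s₀
              (Matrix.diagonal a)) x) ∈ GammaK n k ∧
        g x ≤ Skl n k l (hessianMatrix
            (wGSym n (k - l) (((k : ℝ) - l) / (2 * Hk n k (Matrix.diagonal a))) C₀ β c₁ c₂ s₀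
              (Matrix.diagonal a)) x)) ∧
      MeasureTheory.IntegrableOn
        (fun η => Wsub (k - l) (((k : ℝ) - l) / (2 * Hk n k (Matrix.diagonal a))) C₀ β c₁ η - 1)
        (Set.Ioi s₀) MeasureTheory.volume ∧
      (β ≠ ((k : ℝ) - l) / Hk n k (Matrix.diagonal a) →
        ∃ C R : ℝ, ∀ x : EuclideanSpace ℝ (Fin n), R ≤ ‖x‖ →
          |wGSym n (k - l) (((k : ℝ) - l) / (2 * Hk n k (Matrix.diagonal a))) C₀ β c₁ c₂ s₀
              (Matrix.diagonal a) x -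
            (quadForm (Matrix.diagonal a) x +
              (c₂ - s₀ + ∫ η in Set.Ioi s₀,
                (Wsub (k - l) (((k : ℝ) - l) / (2 * Hk n k (Matrix.diagonal a))) C₀ β c₁ η - 1)))| ≤
          C * ‖x‖ ^ (2 - min β (((k : ℝ) - l) / Hk n k (Matrix.diagonal a)))) ∧
      (β = ((k : ℝ) - l) / Hk n k (Matrix.diagonal a) →
        ∃ C R : ℝ, 1 < R ∧ ∀ x : EuclideanSpace ℝ (Fin n), R ≤ ‖x‖ →
          |wGSym n (k - l) (((k : ℝ) - l) / (2 * Hk n k (Matrix.diagonal a))) C₀ β c₁ c₂ s₀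
              (Matrix.diagonal a) x -
            (quadForm (Matrix.diagonal a) x +
              (c₂ - s₀ + ∫ η in Set.Ioi s₀,
                (Wsub (k - l) (((k : ℝ) - l) / (2 * Hk n k (Matrix.diagonal a))) C₀ β c₁ η - 1)))| ≤
          C * ‖x‖ ^ (2 - ((k : ℝ) - l) / Hk n k (Matrix.diagonal a)) * Real.log ‖x‖) := by
  have ha : ∀ i, 0 < a i := Matrix.posDef_diagonal_iff.1 hApd
  have hh := Hk_diagonal_pos ha (show 0 < k by omega) hkn
  set h := Hk n k (Matrix.diagonal a) with hh_def
  set m := k - l with hm_def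
  have hm : 1 ≤ m := by omega
  have hmR : (k : ℝ) - l = m := by rw [hm_def, Nat.cast_sub hlk.le]
  have hS : esym n k a = esym n l a := by
    rw [Skl, esym_eigs_diagonal, esym_eigs_diagonal,
      div_eq_one_iff_eq (esym_pos ha (by omega)).ne'] at hA1
    exact hA1
  rw [hmR] at hAH ⊢
  have hmh : (m : ℝ) / h = 2 * ((m : ℝ) / (2 * h)) := by field_simp
  rw [hmh]
  set Hc := (m : ℝ) / (2 * h) with hHc
  have hH1 : 1 < Hc := by
    rw [hHc, lt_div_iff₀ (by positivity)]
    linarith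
  have hHh : Hc * (2 * h) = m := by rw [hHc]; field_simp
  have hH : 0 < Hc := by linarith
  have hC : 0 ≤ C₀ := by linarith
  have hβ0 : 0 ≤ β := by linarith
  refine ⟨1 + C₀, by linarith, fun c₁ hc₁ c₂ => ?_⟩
  have hc := hc₁.le
  obtain ⟨c, hc0, hcx⟩ := exists_mul_norm_sq_le_quadForm ha (show 0 < n by omega)
  have hlarge : ∀ x : EuclideanSpace ℝ (Fin n), max 3 (s₀ / c) ≤ ‖x‖ →
      s₀ ≤ quadForm (Matrix.diagonal a) x := by
    intro x hx
    have h3 : 3 ≤ ‖x‖ := (le_max_left _ _).trans hx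
    have h4 : s₀ ≤ ‖x‖ * c := (div_le_iff₀ hc0).1 ((le_max_right _ _).trans hx)
    nlinarith [hcx x]
  have hint : IntegrableOn (fun η => Wsub m Hc C₀ β c₁ η - 1) (Set.Ioi s₀) := by
    rcases eq_or_ne Hc (β / 2) with heq | hne
    · obtain ⟨K, L, -, -, hK⟩ := exists_tail_le_log hm hH1 hC hc heq
      exact (hK s₀ hs₀).1
    · obtain ⟨K, -, hK⟩ := exists_tail_le_rpow hm hH1 hC hβ hc hne
      exact (hK s₀ hs₀).1
  refine ⟨fun x hx => ?_, hint, fun hne => ?_, fun heq => ?_⟩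
  · have hs1 : 1 < quadForm (Matrix.diagonal a) x := lt_of_lt_of_le hs₀ hx
    obtain ⟨W', hW, hW', hode⟩ := exists_hasDerivAt_Wsub hm hH hC hβ0 hc hs1
    have hWpos := lt_of_lt_of_le one_pos (one_le_Wsub (m := m) (Hc := Hc) hC hβ0 hc hs1.le)
    have hess : hessianMatrix (wGSym n m Hc C₀ β c₁ c₂ s₀ (Matrix.diagonal a)) x = _ :=
      hessianMatrix_comp_quadForm a x hs1
        (fun s hs => hasDerivAt_wProfile hm hH hC hβ0 hc c₂ hs₀ hs) hW
    rw [hess]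
    have hG : 0 < gbar C₀ β (quadForm (Matrix.diagonal a) x) := by
      have := Real.rpow_nonneg (show 0 ≤ quadForm (Matrix.diagonal a) x by linarith) (-β / 2)
      unfold gbar
      positivity
    have key := rank_one_subsolution ha hlk hkn hS hWpos hW' x hG (by
      rw [← hh_def]
      have hWm : Wsub m Hc C₀ β c₁ (quadForm (Matrix.diagonal a) x) ^ m =
          Wsub m Hc C₀ β c₁ (quadForm (Matrix.diagonal a) x) ^ (m - 1) *
            Wsub m Hc C₀ β c₁ (quadForm (Matrix.diagonal a) x) := by
        rw [← pow_succ]; congr 1; omega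
      rw [hWm, eq_div_iff (by linarith), ← hHh] at hode
      have := mul_left_cancel₀ hH.ne' (hode.symm.trans (by ring :
        _ = Hc * (2 * h * Wsub m Hc C₀ β c₁ (quadForm (Matrix.diagonal a) x) ^ (m - 1) * W' *
          quadForm (Matrix.diagonal a) x)))
      linear_combination -this)
    exact ⟨key.1, (hup x hx).trans key.2⟩
  · obtain ⟨K, hK0, hK⟩ := exists_tail_le_rpow hm hH1 hC hβ hc
      (fun he => hne (by rw [he]; ring))
    refine ⟨K * c ^ (1 - min (β / 2) Hc), max 3 (s₀ / c), fun x hx => ?_⟩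
    have hxs := hlarge x hx
    have hx0 : 0 < ‖x‖ := by linarith [(le_max_left _ _).trans hx]
    obtain ⟨-, ht0, ht⟩ := hK _ (lt_of_lt_of_le hs₀ hxs)
    rw [wGSym, wProfile_sub_eq hm hH hC hβ0 hc c₂ hs₀ hxs hint, abs_neg, abs_of_nonneg ht0]
    have hp : 1 - min (β / 2) Hc ≤ 0 := by
      have : 1 < min (β / 2) Hc := lt_min (by linarith) hH1
      linarith
    have hexp : 2 - min β (2 * Hc) = 2 * (1 - min (β / 2) Hc) := by
      rw [mul_sub, mul_min_of_nonneg _ _ (by norm_num : (0 : ℝ) ≤ 2)]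
      ring_nf
    rw [hexp, mul_assoc]
    exact ht.trans (mul_le_mul_of_nonneg_left (rpow_le_of_mul_sq_le hc0 hx0 (hcx x) hp) hK0)
  · obtain ⟨K, L, hK0, hL0, hK⟩ := exists_tail_le_log hm hH1 hC hc
      (show Hc = β / 2 by linarith)
    set D := ∑ i, a i
    refine ⟨c ^ (1 - Hc) * (K * (|Real.log D| + 2) + L), max 3 (s₀ / c),
      lt_of_lt_of_le (by norm_num) (le_max_left _ _), fun x hx => ?_⟩
    have hxs := hlarge x hx
    have hx3 : 3 ≤ ‖x‖ := (le_max_left _ _).trans hx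
    have hx0 : 0 < ‖x‖ := by linarith
    have hs1 := lt_of_lt_of_le hs₀ hxs
    obtain ⟨-, ht0, ht⟩ := hK _ hs1
    rw [wGSym, wProfile_sub_eq hm hH hC hβ0 hc c₂ hs₀ hxs hint, abs_neg, abs_of_nonneg ht0]
    have hD : 0 < D := Finset.sum_pos (fun i _ => ha i) ⟨⟨0, by omega⟩, Finset.mem_univ _⟩
    have hlog1 : 1 ≤ Real.log ‖x‖ := by
      rw [Real.le_log_iff_exp_le hx0]
      linarith [Real.exp_one_lt_d9]
    have hlog : Real.log (quadForm (Matrix.diagonal a) x) ≤ Real.log D + 2 * Real.log ‖x‖ := by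
      have := Real.log_le_log (by linarith) (quadForm_le_mul_norm_sq ha x)
      rwa [Real.log_mul hD.ne' (by positivity), Real.log_pow] at this
    have hlog2 : Real.log (quadForm (Matrix.diagonal a) x) ≤
        (|Real.log D| + 2) * Real.log ‖x‖ := by
      nlinarith [le_abs_self (Real.log D), abs_nonneg (Real.log D)]
    have h1 : K * Real.log (quadForm (Matrix.diagonal a) x) + L ≤
        (K * (|Real.log D| + 2) + L) * Real.log ‖x‖ := by
      nlinarith [mul_le_mul_of_nonneg_left hlog2 hK0]
    have h2 := rpow_le_of_mul_sq_le hc0 hx0 (hcx x) (show 1 - Hc ≤ 0 by linarith)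
    have h3 : 0 ≤ K * Real.log (quadForm (Matrix.diagonal a) x) + L := by
      have := Real.log_nonneg hs1.le
      positivity
    refine ht.trans ((mul_le_mul h2 h1 h3 (by positivity)).trans (le_of_eq ?_))
    rw [show 2 - 2 * Hc = 2 * (1 - Hc) by ring]
    ring
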